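/- Let R be an integral domain and M a w-finitely generated, w-flat R-module. Then M is w-projective; explicitly: write tor(M) for the GV-torsion submodule of M; then for every injective R-linear map ι : M/tor(M) → C into a w-module C such that C/ι(M/tor(M)) is GV-torsion, and for every torsion-free w-module N, the group Ext¹_R(C, N) is GV-torsion. -/

import Mathlib

open TensorProduct CategoryTheory

/-- A finitely generated ideal `J` is a GV-ideal if the natural map
`R → Hom_R(J, R)`, sending `r` to multiplication by `r`, is bijective. -/
def IsGVIdeal {R : Type*} [CommRing R] (J : Ideal R) : Prop :=
  J.FG ∧ Function.Bijective fun r : R => (r • J.subtype : J →ₗ[R] R)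

/-- An element `m` of an `R`-module is a GV-torsion element if it is
annihilated by some GV-ideal. -/
def IsGVTorsionElem (R : Type*) [CommRing R] {M : Type*} [AddCommGroup M] [Module R M]
    (m : M) : Prop :=
  ∃ J : Ideal R, IsGVIdeal J ∧ ∀ j ∈ J, j • m = 0

/-- An `R`-module `M` is `w`-finitely generated if it has a finitely generated
submodule `N` such that `M/N` is GV-torsion. -/
def IsWFinitelyGenerated (R : Type*) [CommRing R] (M : Type*) [AddCommGroup M]
    [Module R M] : Prop :=
  ∃ N : Submodule R M, N.FG ∧ ∀ x : M ⧸ N, IsGVTorsionElem R x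

/-- The GV-torsion submodule `tor(M)` of `M`: the set of GV-torsion elements of `M`
(which is a submodule, here realized as the span of that set; the set of GV-torsion
elements is closed under the module operations, so the span coincides with it). -/
def gvTorsionSubmodule (R : Type*) [CommRing R] (M : Type*) [AddCommGroup M]
    [Module R M] : Submodule R M :=
  Submodule.span R {m : M | IsGVTorsionElem R m}

/-- A GV-torsion-free `R`-module `N` is a `w`-module if `Ext¹_R(R/J, N) = 0`
for every GV-ideal `J`. -/
def IsWModule (R : Type u) [CommRing R] (N : Type u) [AddCommGroup N] [Module R N] : Prop :=
  (∀ n : N, IsGVTorsionElem R n → n = 0) ∧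
  ∀ J : Ideal R, IsGVIdeal J →
    Subsingleton (((Ext R (ModuleCat.{u} R) 1).obj
      (Opposite.op (ModuleCat.of R (R ⧸ J)))).obj (ModuleCat.of R N))


/-- The opposite of a linear category is linear. -/
instance oppositeLinear (R : Type*) [CommRing R] (C : Type*) [Category C] [Preadditive C]
    [Linear R C] : Linear R Cᵒᵖ where
  homModule X Y :=
    { smul := fun r f => (r • f.unop).op
      one_smul := fun f => Quiver.Hom.unop_inj (one_smul R f.unop)
      mul_smul := fun r s f => Quiver.Hom.unop_inj (mul_smul r s f.unop)
      smul_zero := fun r => Quiver.Hom.unop_inj (smul_zero (A := Y.unop ⟶ X.unop) r)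
      smul_add := fun r f g => Quiver.Hom.unop_inj (smul_add r f.unop g.unop)
      add_smul := fun r s f => Quiver.Hom.unop_inj (add_smul r s f.unop)
      zero_smul := fun f => Quiver.Hom.unop_inj (zero_smul R f.unop) }
  smul_comp _ _ _ r f g := Quiver.Hom.unop_inj (Linear.comp_smul _ _ _ g.unop r f.unop)
  comp_smul _ _ _ f r g := Quiver.Hom.unop_inj (Linear.smul_comp _ _ _ r g.unop f.unop)

lemma leftDerived_map_smul_id {R : Type*} [CommRing R] {C D : Type*} [Category C] [Category D]
    [Abelian C] [HasProjectiveResolutions C] [Abelian D] [Linear R C] [Linear R D]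
    (F : C ⥤ D) [F.Additive] [F.Linear R] (n : ℕ) (X : C) (r : R) :
    (F.leftDerived n).map (r • 𝟙 X) = r • 𝟙 ((F.leftDerived n).obj X) := by
  let P := projectiveResolution X
  rw [F.leftDerived_map_eq n (r • 𝟙 X) (P := P) (Q := P) (r • 𝟙 P.complex) (by
    ext
    simp only [HomologicalComplex.comp_f, HomologicalComplex.smul_f_apply,
      ChainComplex.single₀_map_f_zero, Linear.smul_comp, HomologicalComplex.id_f]
    erw [Linear.comp_smul, Category.comp_id, Category.id_comp])]
  have h : (F.mapHomologicalComplex _ ⋙ HomologicalComplex.homologyFunctor D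
      (ComplexShape.down ℕ) n).map (r • 𝟙 P.complex) = r • 𝟙 _ := by
    rw [Functor.comp_map, Functor.map_smul]
    rw [CategoryTheory.Functor.map_id]
    exact (ShortComplex.homologyMap_smul (𝟙 (((F.mapHomologicalComplex _).obj P.complex).sc n))
      r).trans (congrArg (r • ·) (ShortComplex.homologyMap_id _))
  rw [h]
  simp only [Linear.smul_comp, Linear.comp_smul]
  congr 1
  erw [Category.id_comp, Iso.hom_inv_id]

lemma ext_smul_eq_zero {R : Type u} [CommRing R] (X Y F : ModuleCat.{u} R) [Projective F]
    (a : X ⟶ F) (b : F ⟶ X) (r : R) (h : a ≫ b = r • 𝟙 X) (n : ℕ)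
    (x : ((Ext R (ModuleCat.{u} R) (n + 1)).obj (Opposite.op X)).obj Y) : r • x = 0 := by
  let G := ((linearYoneda R (ModuleCat.{u} R)).obj Y).rightOp
  have : G.Linear R := ⟨fun {A B} f r => Quiver.Hom.unop_inj (ModuleCat.hom_ext
    (LinearMap.ext fun g => Linear.smul_comp A B Y r f g))⟩
  have h1 := leftDerived_map_smul_id G (n + 1) X r
  have h2 : (G.leftDerived (n + 1)).map (a ≫ b) = 0 := by
    rw [Functor.map_comp]
    rw [(G.isZero_leftDerived_obj_projective_succ n F).eq_of_tgt ((G.leftDerived (n+1)).map a) 0]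
    exact Limits.zero_comp
  rw [h, h1] at h2
  exact LinearMap.congr_fun (congrArg (fun f => f.unop.hom) h2) x

section GVIdeal

variable {R : Type*} [CommRing R]

lemma IsGVIdeal.eq_zero {J : Ideal R} (hJ : IsGVIdeal J) {r : R} (h : ∀ j ∈ J, r * j = 0) :
    r = 0 :=
  hJ.2.1 (a₁ := r) (a₂ := 0) (LinearMap.ext fun j => by simpa using h j j.2)

lemma IsGVIdeal.exists_eq_mul {J : Ideal R} (hJ : IsGVIdeal J) (f : J →ₗ[R] R) :
    ∃ r : R, ∀ j : J, f j = r * j := by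
  obtain ⟨r, hr⟩ := hJ.2.2 f
  exact ⟨r, fun j => by simp [← hr]⟩

lemma isGVIdeal_of_exists {J : Ideal R} (hfg : J.FG) (h0 : ∀ r : R, (∀ j ∈ J, r * j = 0) → r = 0)
    (h : ∀ f : J →ₗ[R] R, ∃ r : R, ∀ j : J, f j = r * j) : IsGVIdeal J := by
  refine ⟨hfg, fun a b hab => ?_, fun f => ?_⟩
  · refine sub_eq_zero.1 (h0 _ fun j hj => ?_)
    have := LinearMap.congr_fun hab ⟨j, hj⟩
    simp only [LinearMap.smul_apply, Submodule.subtype_apply, smul_eq_mul] at this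
    rw [sub_mul, this, sub_self]
  · obtain ⟨r, hr⟩ := h f
    exact ⟨r, LinearMap.ext fun j => by simp [hr]⟩

lemma isGVIdeal_top : IsGVIdeal (⊤ : Ideal R) := by
  refine isGVIdeal_of_exists ⟨{1}, by simp⟩ (fun r h => by simpa using h 1 trivial) fun f => ?_
  refine ⟨f ⟨1, trivial⟩, fun j => ?_⟩
  rw [mul_comm, ← smul_eq_mul, ← map_smul]
  congr 1
  ext
  simp

lemma IsGVIdeal.mul {I J : Ideal R} (hI : IsGVIdeal I) (hJ : IsGVIdeal J) :
    IsGVIdeal (I * J) := by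
  refine isGVIdeal_of_exists (hI.1.mul hJ.1) (fun r h => ?_) fun f => ?_
  · refine hI.eq_zero fun i hi => hJ.eq_zero fun j hj => ?_
    rw [mul_assoc]
    exact h _ (Ideal.mul_mem_mul hi hj)
  · let m (i : I) : J →ₗ[R] (I * J : Ideal R) :=
      { toFun := fun j => ⟨i * j, Ideal.mul_mem_mul i.2 j.2⟩
        map_add' := fun a b => Subtype.ext (by simp [mul_add])
        map_smul' := fun a b => Subtype.ext (by simp [mul_left_comm]) }
    choose g hg using fun i : I => hJ.exists_eq_mul (f ∘ₗ m i)
    let G : I →ₗ[R] R :=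
      { toFun := g
        map_add' := fun a b => by
          refine sub_eq_zero.1 (hJ.eq_zero fun j hj => ?_)
          have e : m (a + b) ⟨j, hj⟩ = m a ⟨j, hj⟩ + m b ⟨j, hj⟩ :=
            Subtype.ext (by simp [m, add_mul])
          have h1 := hg (a + b) ⟨j, hj⟩
          have h2 := hg a ⟨j, hj⟩
          have h3 := hg b ⟨j, hj⟩
          simp only [LinearMap.comp_apply, e, map_add] at h1 h2 h3
          rw [sub_mul, add_mul, ← h1, ← h2, ← h3, sub_self]
        map_smul' := fun a b => by
          refine sub_eq_zero.1 (hJ.eq_zero fun j hj => ?_)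
          have e : m (a • b) ⟨j, hj⟩ = a • m b ⟨j, hj⟩ :=
            Subtype.ext (by simp [m, mul_assoc])
          have h1 := hg (a • b) ⟨j, hj⟩
          have h2 := hg b ⟨j, hj⟩
          simp only [LinearMap.comp_apply, e, map_smul, smul_eq_mul] at h1 h2
          simp only [RingHom.id_apply, smul_eq_mul]
          rw [sub_mul, mul_assoc, ← h1, ← h2, sub_self] }
    obtain ⟨r, hr⟩ := hI.exists_eq_mul G
    refine ⟨r, ?_⟩
    rintro ⟨x, hx⟩
    induction hx using Submodule.mul_induction_on' with
    | mem_mul_mem i hi j hj =>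
      have h1 := hg ⟨i, hi⟩ ⟨j, hj⟩
      have h2 : g ⟨i, hi⟩ = r * i := hr ⟨i, hi⟩
      simp only [LinearMap.comp_apply, h2, mul_assoc] at h1
      exact h1
    | add x hx y hy h1 h2 =>
      have := congrArg₂ (· + ·) h1 h2
      simp only [← map_add, ← mul_add] at this
      exact this

/-- An ideal containing no GV-ideal lies in a prime ideal containing no GV-ideal. -/
lemma exists_isPrime_of_forall_isGVIdeal_not_le (I : Ideal R)
    (hI : ∀ J : Ideal R, IsGVIdeal J → ¬ J ≤ I) :
    ∃ p : Ideal R, p.IsPrime ∧ I ≤ p ∧ ∀ J : Ideal R, IsGVIdeal J → ¬ J ≤ p := by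
  obtain ⟨p, hIp, hp⟩ := zorn_le_nonempty₀ {I : Ideal R | ∀ J : Ideal R, IsGVIdeal J → ¬ J ≤ I}
    (fun c hc hchain y hy => by
      refine ⟨sSup c, fun J hJ hle => ?_, fun z hz => le_sSup hz⟩
      obtain ⟨z, hz, hJz⟩ := (Submodule.fg_iff_compact J).1 hJ.1 c _ ⟨y, hy⟩ hchain.directedOn
        (isLUB_sSup c) hle
      exact hc hz J hJ hJz) I hI
  have key : ∀ a, a ∉ p → ∃ J, IsGVIdeal J ∧ J ≤ p ⊔ Ideal.span {a} := fun a ha => by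
    by_contra! h
    exact ha (hp.2 (y := p ⊔ Ideal.span {a}) h le_sup_left
      (Ideal.mem_sup_right (Ideal.mem_span_singleton_self a)))
  refine ⟨p, ⟨fun h => hp.1 ⊤ isGVIdeal_top h.ge, fun {a b} hab => ?_⟩, hIp, hp.1⟩
  by_contra! h
  obtain ⟨J, hJ, hJa⟩ := key a h.1
  obtain ⟨K, hK, hKb⟩ := key b h.2
  refine hp.1 _ (hJ.mul hK) ((Ideal.mul_mono hJa hKb).trans ?_)
  rw [Ideal.sup_mul, Ideal.mul_sup (Ideal.span {a}), Ideal.span_singleton_mul_span_singleton]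
  refine sup_le Ideal.mul_le_left (sup_le Ideal.mul_le_right ?_)
  rwa [Ideal.span_singleton_le_iff_mem]

variable {M : Type*} [AddCommGroup M] [Module R M]

lemma isGVTorsionElem_of_mem_gvTorsionSubmodule {m : M} (hm : m ∈ gvTorsionSubmodule R M) :
    IsGVTorsionElem R m := by
  induction hm using Submodule.span_induction with
  | mem x h => exact h
  | zero => exact ⟨⊤, isGVIdeal_top, by simp⟩
  | add x y _ _ hx hy =>
    obtain ⟨I, hI, hx⟩ := hx
    obtain ⟨J, hJ, hy⟩ := hy
    refine ⟨I * J, hI.mul hJ, fun j hj => ?_⟩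
    have h1 : I * J ≤ I := Ideal.mul_le_left
    have h2 : I * J ≤ J := Ideal.mul_le_right
    rw [smul_add, hx j (h1 hj), hy j (h2 hj), add_zero]
  | smul a x _ hx =>
    obtain ⟨I, hI, hx⟩ := hx
    exact ⟨I, hI, fun j hj => by rw [smul_comm, hx j hj, smul_zero]⟩

/-- In a GV-torsion-free module, the span of a finite linearly independent family is closed
under taking `w`-envelopes. -/
lemma LinearIndependent.mem_span_of_isGVIdeal (htf : ∀ m : M, IsGVTorsionElem R m → m = 0)
    {ι : Type*} [Fintype ι] {c : ι → M} (hc : LinearIndependent R c) {J : Ideal R}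
    (hJ : IsGVIdeal J) {y : M} (hy : ∀ j ∈ J, j • y ∈ Submodule.span R (Set.range c)) :
    y ∈ Submodule.span R (Set.range c) := by
  let g : J →ₗ[R] Submodule.span R (Set.range c) :=
    ((LinearMap.toSpanSingleton R M y).comp J.subtype).codRestrict _ fun j => hy j j.2
  choose r hr using fun i : ι => hJ.exists_eq_mul (Finsupp.lapply i ∘ₗ hc.repr ∘ₗ g)
  have hy' : y = ∑ i, r i • c i := by
    refine sub_eq_zero.1 (htf _ ⟨J, hJ, fun j hj => ?_⟩)
    have h1 := hc.linearCombination_repr (g ⟨j, hj⟩)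
    rw [Finsupp.linearCombination_apply, Finsupp.sum_fintype _ _ (by simp)] at h1
    have h2 : ∀ i, hc.repr (g ⟨j, hj⟩) i = r i * j := fun i => hr i ⟨j, hj⟩
    simp only [h2] at h1
    rw [smul_sub, Finset.smul_sum, sub_eq_zero]
    refine Eq.trans h1.symm (Finset.sum_congr rfl fun i _ => ?_)
    rw [mul_comm, mul_smul]
  rw [hy']
  exact Submodule.sum_mem _ fun i _ => Submodule.smul_mem _ _ (Submodule.subset_span ⟨i, rfl⟩)

end GVIdeal

/-- Equational criterion for `w`-flat modules: every linear relation becomes trivial after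
multiplication by any element of a suitable GV-ideal. -/
lemma exists_isGVIdeal_vanishesTrivially {R : Type u} [CommRing R] {M : Type u} [AddCommGroup M]
    [Module R M]
    (hflat : ∀ (A B : Type u) [AddCommGroup A] [Module R A] [AddCommGroup B] [Module R B]
      (f : A →ₗ[R] B), Function.Injective f →
        ∀ x ∈ LinearMap.ker (LinearMap.rTensor M f), IsGVTorsionElem R x)
    {ι : Type*} [Fintype ι] (r : ι → R) (m : ι → M) (h : ∑ i, r i • m i = 0) :
    ∃ J : Ideal R, IsGVIdeal J ∧ ∀ j ∈ J, VanishesTrivially R r (fun i => j • m i) := by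
  let a : Ideal R := Ideal.span (Set.range r)
  let r' : ι → a := fun i => ⟨r i, Ideal.subset_span ⟨i, rfl⟩⟩
  obtain ⟨J, hJ, hJx⟩ := hflat a R a.subtype a.injective_subtype (∑ i, r' i ⊗ₜ[R] m i) (by
    rw [LinearMap.mem_ker, map_sum]
    apply (TensorProduct.lid R M).injective
    simpa [r'] using h)
  refine ⟨J, hJ, fun j hj => ?_⟩
  have hspan : Submodule.span R (Set.range r') = ⊤ := by
    apply Submodule.map_injective_of_injective a.injective_subtype
    rw [Submodule.map_span, Submodule.map_top, Submodule.range_subtype, ← Set.range_comp]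
    rfl
  obtain ⟨k, A, y, hy, hA⟩ := TensorProduct.vanishesTrivially_of_sum_tmul_eq_zero R hspan
    (n := fun i => j • m i) (by simpa [Finset.smul_sum] using hJx j hj)
  exact ⟨k, A, y, hy, fun l => by simpa [r'] using congrArg Subtype.val (hA l)⟩

/-- If a scaled vector family `u • c` is fixed up to a singular matrix `T`, then modulo a prime
not containing `u`, some entry of `u • 1 - T` is nonzero. -/
lemma exists_notMem_of_det_eq_zero {R : Type*} [CommRing R] {ι : Type*} [Fintype ι]
    [DecidableEq ι] (p : Ideal R) [p.IsPrime] {u : R} (hu : u ∉ p) {T : Matrix ι ι R}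
    (hT : T.det = 0) : ∃ k l, (u • (1 : Matrix ι ι R) - T) k l ∉ p := by
  by_contra! h
  have h1 : (Ideal.Quotient.mk p).mapMatrix T =
      (Ideal.Quotient.mk p).mapMatrix (u • (1 : Matrix ι ι R)) := by
    ext k l
    exact ((Ideal.Quotient.mk_eq_mk_iff_sub_mem _ _).2 (h k l)).symm
  have h2 := congrArg Matrix.det h1
  rw [← RingHom.map_det, ← RingHom.map_det, hT, map_zero, Matrix.det_smul, Matrix.det_one, mul_one,
    eq_comm, Ideal.Quotient.eq_zero_iff_mem] at h2
  exact hu (Ideal.IsPrime.mem_of_pow_mem ‹_› _ h2)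

section Descent

variable {R : Type u} [CommRing R] [IsDomain R] {M C : Type u} [AddCommGroup M] [Module R M]
  [AddCommGroup C] [Module R C]

/-- A linearly dependent family that generates `s • φ(M)` up to GV-torsion can be shortened,
away from a prime ideal containing no GV-ideal. -/
lemma exists_erase_of_not_linearIndependent [DecidableEq M]
    (hflat : ∀ (A B : Type u) [AddCommGroup A] [Module R A] [AddCommGroup B] [Module R B]
      (f : A →ₗ[R] B), Function.Injective f →
        ∀ x ∈ LinearMap.ker (LinearMap.rTensor M f), IsGVTorsionElem R x)
    (φ : M →ₗ[R] C) (hker : ∀ m, φ m = 0 → IsGVTorsionElem R m)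
    (p : Ideal R) [p.IsPrime] (hp : ∀ J : Ideal R, IsGVIdeal J → ¬ J ≤ p)
    (S : Finset M) (hS : ¬ LinearIndependent R (fun m : S => φ m)) {s : R} (hs : s ∉ p)
    (hgen : ∀ x : M, ∃ J : Ideal R, IsGVIdeal J ∧
      ∀ j ∈ J, j • s • φ x ∈ Submodule.span R (φ '' S)) :
    ∃ l ∈ S, ∃ e ∉ p, ∀ x : M, ∃ J : Ideal R, IsGVIdeal J ∧
      ∀ j ∈ J, j • e • φ x ∈ Submodule.span R (φ '' (S.erase l)) := by
  have himg : φ '' S = Set.range fun m : S => φ m := by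
    ext z
    simp
  obtain ⟨g, hg, i₀, hi₀⟩ := Fintype.not_linearIndependent_iff.1 hS
  obtain ⟨J₀, hJ₀, hJ₀g⟩ := hker (∑ i, g i • (i : M)) (by simpa using hg)
  obtain ⟨j₀, hj₀, hj₀p⟩ := SetLike.not_le_iff_exists.1 (hp J₀ hJ₀)
  obtain ⟨J, hJ, hJv⟩ := exists_isGVIdeal_vanishesTrivially hflat (fun i => j₀ * g i)
    (fun i : S => (i : M)) (by simpa [mul_smul, Finset.smul_sum] using hJ₀g j₀ hj₀)
  obtain ⟨j, hj, hjp⟩ := SetLike.not_le_iff_exists.1 (hp J hJ)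
  obtain ⟨k, A, y, hy, hA⟩ := hJv j hj
  have ht : ∀ l, ∃ t ∉ p, t • s • φ (y l) ∈ Submodule.span R (φ '' S) := fun l => by
    obtain ⟨K, hK, hKy⟩ := hgen (y l)
    obtain ⟨t, ht, htp⟩ := SetLike.not_le_iff_exists.1 (hp K hK)
    exact ⟨t, htp, hKy t ht⟩
  choose t htp ht using ht
  have hprod : ∏ l, t l ∉ p := fun h => by
    obtain ⟨l, -, hl⟩ := (Ideal.IsPrime.prod_mem_iff).1 h
    exact htp l hl
  have hb : ∀ l, ∃ b : S → R, ∑ i, b i • φ i = (∏ l, t l) • s • φ (y l) := fun l => by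
    rw [← Submodule.mem_span_range_iff_exists_fun, ← himg,
      ← Finset.prod_erase_mul _ _ (Finset.mem_univ l), mul_smul]
    exact Submodule.smul_mem _ _ (ht l)
  choose B hB using hb
  let T : Matrix S S R := Matrix.of A * Matrix.of B
  set u := (∏ l, t l) * s * j with hu
  have hup : u ∉ p := fun h => by
    rcases Ideal.IsPrime.mem_or_mem ‹_› h with h | h
    · exact (Ideal.IsPrime.mem_or_mem ‹_› h).elim hprod hs
    · exact hjp h
  have hT : ∀ i, ∑ k, T i k • φ k = u • φ i := fun i => by
    have h1 : u • φ i = ∑ l, A i l • ((∏ l, t l) • s • φ (y l)) := by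
      rw [hu, mul_smul, ← map_smul, show j • (i : M) = _ from hy i, map_sum, Finset.smul_sum]
      refine Finset.sum_congr rfl fun l _ => ?_
      rw [map_smul, smul_comm, mul_smul]
    rw [h1]
    simp only [← hB, T, Matrix.mul_apply, Finset.sum_smul, Finset.smul_sum, Matrix.of_apply,
      mul_smul]
    exact Finset.sum_comm
  have hdet : T.det = 0 := by
    refine Matrix.exists_vecMul_eq_zero_iff.1 ⟨fun i => j₀ * g i, fun h => ?_, ?_⟩
    · rcases mul_eq_zero.1 (congrFun h i₀) with h | h
      · exact hj₀p (h ▸ p.zero_mem)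
      · exact hi₀ h
    · rw [← Matrix.vecMul_vecMul]
      have h : Matrix.vecMul (fun i => j₀ * g i) (Matrix.of A) = 0 := by
        ext l
        simpa [Matrix.vecMul, dotProduct, mul_comm] using hA l
      rw [h, Matrix.zero_vecMul]
  obtain ⟨k, l, hkl⟩ := exists_notMem_of_det_eq_zero p hup hdet
  set E := u • (1 : Matrix S S R) - T with hE
  have hEc : ∑ i, E k i • φ i = 0 := by
    simp only [hE, Matrix.sub_apply, sub_smul, Finset.sum_sub_distrib, hT]
    simp [Matrix.one_apply]
  have hmem : ∀ z ∈ Submodule.span R (φ '' S),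
      E k l • z ∈ Submodule.span R (φ '' (S.erase l)) := by
    intro z hz
    induction hz using Submodule.span_induction with
    | mem z hz =>
      obtain ⟨m, hm, rfl⟩ := hz
      by_cases hml : m = l
      · rw [← Finset.sum_erase_add _ _ (Finset.mem_univ l)] at hEc
        rw [hml, eq_neg_of_add_eq_zero_right hEc]
        refine Submodule.neg_mem _ (Submodule.sum_mem _ fun i hi => Submodule.smul_mem _ _ ?_)
        exact Submodule.subset_span ⟨i, Finset.mem_coe.2 (Finset.mem_erase.2
          ⟨fun h => (Finset.mem_erase.1 hi).1 (Subtype.ext h), i.2⟩), rfl⟩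
      · exact Submodule.smul_mem _ _ (Submodule.subset_span ⟨m, Finset.mem_coe.2
          (Finset.mem_erase.2 ⟨hml, hm⟩), rfl⟩)
    | zero => simp
    | add a b _ _ ha hb => rw [smul_add]; exact Submodule.add_mem _ ha hb
    | smul a z _ hz => rw [smul_comm]; exact Submodule.smul_mem _ _ hz
  refine ⟨l, l.2, E k l * s, fun h => (Ideal.IsPrime.mem_or_mem ‹_› h).elim hkl hs, fun x => ?_⟩
  obtain ⟨K, hK, hKx⟩ := hgen x
  refine ⟨K, hK, fun j hj => ?_⟩
  rw [mul_smul, smul_comm]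
  exact hmem _ (hKx j hj)

/-- Away from a prime ideal containing no GV-ideal, `C` is a free module. -/
lemma exists_linearIndependent_smul_mem_span
    (hflat : ∀ (A B : Type u) [AddCommGroup A] [Module R A] [AddCommGroup B] [Module R B]
      (f : A →ₗ[R] B), Function.Injective f →
        ∀ x ∈ LinearMap.ker (LinearMap.rTensor M f), IsGVTorsionElem R x)
    (φ : M →ₗ[R] C) (hker : ∀ m, φ m = 0 → IsGVTorsionElem R m)
    (htf : ∀ c : C, IsGVTorsionElem R c → c = 0)
    (hcoker : ∀ c : C, ∃ J : Ideal R, IsGVIdeal J ∧ ∀ j ∈ J, j • c ∈ LinearMap.range φ)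
    (p : Ideal R) [p.IsPrime] (hp : ∀ J : Ideal R, IsGVIdeal J → ¬ J ≤ p)
    (S : Finset M) {s : R} (hs : s ∉ p)
    (hgen : ∀ x : M, ∃ J : Ideal R, IsGVIdeal J ∧
      ∀ j ∈ J, j • s • φ x ∈ Submodule.span R (φ '' S)) :
    ∃ S : Finset M, LinearIndependent R (fun m : S => φ m) ∧
      ∃ s ∉ p, ∀ c : C, s • c ∈ Submodule.span R (Set.range fun m : S => φ m) := by
  classical
  induction S using Finset.strongInduction generalizing s with
  | H S ih =>
    by_cases hS : LinearIndependent R (fun m : S => φ m)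
    · have himg : φ '' S = Set.range fun m : S => φ m := by
        ext z
        simp
      rw [himg] at hgen
      refine ⟨S, hS, s, hs, fun c => ?_⟩
      obtain ⟨J, hJ, hJc⟩ := hcoker c
      refine hS.mem_span_of_isGVIdeal htf hJ fun j hj => ?_
      obtain ⟨x, hx⟩ := hJc j hj
      obtain ⟨K, hK, hKx⟩ := hgen x
      rw [smul_comm, ← hx]
      exact hS.mem_span_of_isGVIdeal htf hK hKx
    · obtain ⟨l, hl, e, he, hgen'⟩ :=
        exists_erase_of_not_linearIndependent hflat φ hker p hp S hS hs hgen
      exact ih _ (Finset.erase_ssubset hl) he hgen'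

end Descent

lemma smul_ext_eq_zero_of_mem_span {R : Type u} [CommRing R] {C N : Type u} [AddCommGroup C]
    [Module R C] [AddCommGroup N] [Module R N] {ι : Type u} {v : ι → C}
    (hv : LinearIndependent R v) {s : R} (hs : ∀ c : C, s • c ∈ Submodule.span R (Set.range v))
    (n : ℕ) (x : ((Ext R (ModuleCat.{u} R) (n + 1)).obj
      (Opposite.op (ModuleCat.of R C))).obj (ModuleCat.of R N)) : s • x = 0 := by
  have : Projective (ModuleCat.of R (ι →₀ R)) :=
    ModuleCat.projective_of_free (Finsupp.basisSingleOne (R := R) (ι := ι))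
  refine ext_smul_eq_zero _ _ (ModuleCat.of R (ι →₀ R))
    (ModuleCat.ofHom (hv.repr ∘ₗ (s • LinearMap.id (R := R) (M := C)).codRestrict _ hs))
    (ModuleCat.ofHom (Finsupp.linearCombination R v)) s ?_ n x
  ext c
  exact hv.linearCombination_repr _

/-- over an integral domain, every `w`-finitely generated `w`-flat module
is `w`-projective (in the explicit sense via `Ext¹`). -/
theorem wfg_wflat_is_wprojective {R : Type u} [CommRing R] [IsDomain R]
    (M : Type u) [AddCommGroup M] [Module R M]
    (hfg : IsWFinitelyGenerated R M)
    (hflat : ∀ (A B : Type u) [AddCommGroup A] [Module R A] [AddCommGroup B] [Module R B]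
      (f : A →ₗ[R] B), Function.Injective f →
        ∀ x ∈ LinearMap.ker (LinearMap.rTensor M f), IsGVTorsionElem R x) :
    ∀ (C : Type u) [AddCommGroup C] [Module R C]
      (ι : (M ⧸ gvTorsionSubmodule R M) →ₗ[R] C),
      Function.Injective ι → IsWModule R C →
      (∀ x : C ⧸ LinearMap.range ι, IsGVTorsionElem R x) →
      ∀ (N : Type u) [AddCommGroup N] [Module R N], IsWModule R N →
        (∀ (r : R) (n : N), r • n = 0 → r = 0 ∨ n = 0) →
        ∀ x : ((Ext R (ModuleCat.{u} R) 1).obj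
            (Opposite.op (ModuleCat.of R C))).obj (ModuleCat.of R N),
          IsGVTorsionElem R x := by
  intro C _ _ ι hι hC hcoker N _ _ _ _ x
  let φ : M →ₗ[R] C := ι ∘ₗ (gvTorsionSubmodule R M).mkQ
  have hker : ∀ m, φ m = 0 → IsGVTorsionElem R m := fun m hm => by
    refine isGVTorsionElem_of_mem_gvTorsionSubmodule ((Submodule.Quotient.mk_eq_zero _).1 ?_)
    exact hι (hm.trans (map_zero ι).symm)
  have hrange : LinearMap.range φ = LinearMap.range ι :=
    LinearMap.range_comp_of_range_eq_top _ (Submodule.range_mkQ _)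
  have hcoker' : ∀ c : C, ∃ J : Ideal R, IsGVIdeal J ∧ ∀ j ∈ J, j • c ∈ LinearMap.range φ := by
    intro c
    obtain ⟨J, hJ, hJc⟩ := hcoker (Submodule.Quotient.mk c)
    refine ⟨J, hJ, fun j hj => ?_⟩
    rw [hrange, ← Submodule.Quotient.mk_eq_zero, Submodule.Quotient.mk_smul]
    exact hJc j hj
  obtain ⟨_, ⟨S, rfl⟩, hS⟩ := hfg
  have hgen : ∀ x : M, ∃ J : Ideal R, IsGVIdeal J ∧
      ∀ j ∈ J, j • (1 : R) • φ x ∈ Submodule.span R (φ '' S) := fun x => by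
    obtain ⟨J, hJ, hJx⟩ := hS (Submodule.Quotient.mk x)
    refine ⟨J, hJ, fun j hj => ?_⟩
    rw [one_smul, ← map_smul, ← Submodule.map_span]
    refine Submodule.mem_map_of_mem ?_
    rw [← Submodule.Quotient.mk_eq_zero, Submodule.Quotient.mk_smul]
    exact hJx j hj
  by_contra hx
  obtain ⟨p, hprime, hIp, hp⟩ := exists_isPrime_of_forall_isGVIdeal_not_le
    (LinearMap.ker (LinearMap.toSpanSingleton R _ x)) fun J hJ hle => hx ⟨J, hJ, hle⟩
  obtain ⟨S', hS', s, hs, hsC⟩ := exists_linearIndependent_smul_mem_span hflat φ hker hC.1 hcoker'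
    p hp S ((Ideal.ne_top_iff_one p).1 hprime.ne_top) hgen
  exact hs (hIp (smul_ext_eq_zero_of_mem_span hS' hsC 0 x))
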